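/- arXiv:2303.02380 — 3 statements merged into one kernel-verified Lean document; each statement's English description precedes it below -/
import Mathlib

section
/- Fix q ∈ (0,1), m ≥ 1, and x ∈ W_m. Then Υ_m(x,y) ≥ 0 for every y ∈ W_m, and Σ_{y ∈ W_m} Υ_m(x,y) = 1 (the sum is effectively finite, since Υ_m(x,y) = 0 unless y_i ∈ {x_i−1, x_i} for all i). Hence Υ_m is a Markov transition matrix on W_m. -/
/-- `W_m = {x₁ > x₂ > … > x_m ≥ 0}`. -/
def Wm (m : ℕ) (x : Fin m → ℤ) : Prop := StrictAnti x ∧ ∀ i, 0 ≤ x i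

/-- Transition matrix of `m` independent `q`-exchangeable walks. -/
noncomputable def UpsInd (q : ℝ) (m : ℕ) (x y : Fin m → ℤ) : ℝ :=
  ∏ i : Fin m, (q ^ (x i) * (if y i = x i then 1 else 0)
    + (1 - q ^ (x i)) * (if y i = x i - 1 then 1 else 0))

/-- The noncolliding `q`-exchangeable walk transition matrix
`Υ_m(x,y) = q^{−m(m−1)/2+(m−1)(|x|−|y|)} ∏_{i<j} (q^{y_j}−q^{y_i})/(q^{x_j}−q^{x_i}) ·
Υ_{m,ind}(x,y)`. -/
noncomputable def UpsM (q : ℝ) (m : ℕ) (x y : Fin m → ℤ) : ℝ :=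
  q ^ (-((m : ℤ) * ((m : ℤ) - 1) / 2) + ((m : ℤ) - 1) * ((∑ i, x i) - ∑ i, y i)) *
    (∏ i : Fin m, ∏ j ∈ Finset.Ioi i, (q ^ (y j) - q ^ (y i)) / (q ^ (x j) - q ^ (x i))) *
    UpsInd q m x y

/-- The one-particle transition weight of a `q`-exchangeable walk. -/
noncomputable def stepWeight (q : ℝ) (x z : ℤ) : ℝ :=
  q ^ x * (if z = x then 1 else 0) + (1 - q ^ x) * (if z = x - 1 then 1 else 0)

theorem UpsInd_eq_prod_stepWeight (q : ℝ) (m : ℕ) (x y : Fin m → ℤ) :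
    UpsInd q m x y = ∏ i, stepWeight q (x i) (y i) := rfl

theorem stepWeight_eq_zero {q : ℝ} {x z : ℤ} (h : z ∉ ({x - 1, x} : Finset ℤ)) :
    stepWeight q x z = 0 := by
  simp only [Finset.mem_insert, Finset.mem_singleton, not_or] at h
  simp [stepWeight, h.1, h.2]

theorem stepWeight_nonneg {q : ℝ} (hq0 : 0 < q) (hq1 : q < 1) {x : ℤ} (hx : 0 ≤ x) (z : ℤ) :
    0 ≤ stepWeight q x z := by
  have h1 : q ^ x ≤ 1 := zpow_le_one₀ hq0 hq1.le hx
  have h0 : 0 < q ^ x := zpow_pos hq0 x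
  unfold stepWeight
  split_ifs <;> nlinarith

theorem UpsM_nonneg {q : ℝ} (hq0 : 0 < q) (hq1 : q < 1) {m : ℕ} {x y : Fin m → ℤ}
    (hx : Wm m x) (hy : Wm m y) : 0 ≤ UpsM q m x y := by
  have key : ∀ z : Fin m → ℤ, Wm m z → ∀ i j, i < j → 0 ≤ q ^ z j - q ^ z i := by
    intro z hz i j hij
    exact sub_nonneg.2 (zpow_le_zpow_right_of_le_one₀ hq0 hq1.le (hz.1 hij).le)
  refine mul_nonneg (mul_nonneg (zpow_pos hq0 _).le ?_) ?_
  · refine Finset.prod_nonneg fun i _ => Finset.prod_nonneg fun j hj => ?_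
    exact div_nonneg (key y hy i j (Finset.mem_Ioi.1 hj)) (key x hx i j (Finset.mem_Ioi.1 hj))
  · exact Finset.prod_nonneg fun i _ => stepWeight_nonneg hq0 hq1 (hx.2 i) (y i)

/-- From `x ∈ W_m`, every state `y` outside `W_m` is reached with weight zero. -/
theorem UpsM_eq_zero_of_not_Wm {q : ℝ} {m : ℕ} {x y : Fin m → ℤ}
    (hx : Wm m x) (hy : ¬ Wm m y) : UpsM q m x y = 0 := by
  by_contra hne
  obtain ⟨h1, h2⟩ := mul_ne_zero_iff.1 hne
  have h3 := (mul_ne_zero_iff.1 h1).2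
  rw [UpsInd_eq_prod_stepWeight, Finset.prod_ne_zero_iff] at h2
  have hmem : ∀ i, y i = x i - 1 ∨ y i = x i := by
    intro i
    by_contra h
    exact h2 i (Finset.mem_univ i) (stepWeight_eq_zero (by simpa using h))
  refine hy ⟨fun i j hij => ?_, fun i => ?_⟩
  · have hlt := hx.1 hij
    have hyne : y i ≠ y j := by
      intro he
      have := Finset.prod_ne_zero_iff.1 (Finset.prod_ne_zero_iff.1 h3 i (Finset.mem_univ i)) j
        (Finset.mem_Ioi.2 hij)
      simp [he] at this
    have := hmem i
    have := hmem j
    omega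
  · by_contra hneg
    have h0 := hx.2 i
    have hxi : x i = 0 := by have := hmem i; omega
    have hyi : y i ≠ 0 := by omega
    exact h2 i (Finset.mem_univ i) (by simp [stepWeight, hxi, hyi])

/-- The matrix by which averaging over one step acts on the monomials `a ^ k`, `k < m`. -/
def stepMatrix (q : ℝ) (m : ℕ) : Matrix (Fin m) (Fin m) ℝ :=
  Matrix.of fun l k => if l = k then q ^ (m - 1 - (k : ℕ))
    else if (l : ℕ) = k + 1 then 1 - q ^ (m - 1 - (k : ℕ)) else 0

theorem det_stepMatrix (q : ℝ) (m : ℕ) : (stepMatrix q m).det = q ^ (m * (m - 1) / 2) := by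
  rw [Matrix.det_of_isLowerTriangular]
  · simp only [stepMatrix, Matrix.of_apply, if_true]
    rw [Finset.prod_pow_eq_pow_sum, Fin.sum_univ_eq_sum_range (fun k => m - 1 - k),
      Finset.sum_range_reflect (fun k => k), Finset.sum_range_id]
  · intro l k hlk
    have hlk : l < k := hlk
    have h : (l : ℕ) < k := hlk
    have h1 : (l : ℕ) ≠ k + 1 := by omega
    simp [stepMatrix, hlk.ne, h1]

theorem sum_pow_mul_stepMatrix (q a : ℝ) (m : ℕ) (k : Fin m) :
    ∑ l : Fin m, a ^ (l : ℕ) * stepMatrix q m l k =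
      a ^ (k : ℕ) * q ^ (m - 1 - (k : ℕ)) + a ^ ((k : ℕ) + 1) * (1 - q ^ (m - 1 - (k : ℕ))) := by
  have hsplit : ∀ l : Fin m, a ^ (l : ℕ) * stepMatrix q m l k =
      (if l = k then a ^ (k : ℕ) * q ^ (m - 1 - (k : ℕ)) else 0) +
      (if (l : ℕ) = k + 1 then a ^ ((k : ℕ) + 1) * (1 - q ^ (m - 1 - (k : ℕ))) else 0) := by
    intro l
    by_cases h : l = k
    · subst h; simp [stepMatrix]
    · by_cases h' : (l : ℕ) = k + 1 <;> simp [stepMatrix, h, h']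
  rw [Finset.sum_congr rfl fun l _ => hsplit l, Finset.sum_add_distrib]
  congr 1
  · simp
  · by_cases hk : (k : ℕ) + 1 < m
    · rw [Finset.sum_eq_single (⟨k + 1, hk⟩ : Fin m)]
      · simp
      · intro b _ hb
        exact if_neg fun h => hb (Fin.ext h)
      · simp
    · have : m - 1 - (k : ℕ) = 0 := by omega
      simp [this]

theorem sum_stepWeight_mul {q : ℝ} (hq0 : 0 < q) {m : ℕ} (x : ℤ) (k : Fin m) :
    ∑ z ∈ ({x - 1, x} : Finset ℤ),
      (q ^ (((m : ℤ) - 1) * (x - z)) * stepWeight q x z) * (q ^ z) ^ (k : ℕ) =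
      ∑ l : Fin m, (q ^ x) ^ (l : ℕ) * stepMatrix q m l k := by
  have hne : q ≠ 0 := hq0.ne'
  have hk := k.2
  rw [sum_pow_mul_stepMatrix, Finset.sum_pair (by omega)]
  have hpow : q ^ (((m : ℤ) - 1) * (x - (x - 1))) * (q ^ (x - 1)) ^ (k : ℕ) =
      (q ^ x) ^ (k : ℕ) * q ^ (m - 1 - (k : ℕ)) := by
    simp only [← zpow_natCast, ← zpow_mul, ← zpow_add₀ hne]
    congr 1
    have : ((m - 1 - (k : ℕ) : ℕ) : ℤ) = (m : ℤ) - 1 - k := by omega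
    rw [this]
    ring
  have h1 : stepWeight q x (x - 1) = 1 - q ^ x := by simp [stepWeight]
  have h2 : stepWeight q x x = q ^ x := by
    simp [stepWeight, show x ≠ x - 1 by omega]
  rw [h1, h2, mul_right_comm, hpow]
  simp
  ring

/-- Averaging the weighted Vandermonde determinant over one step of independent walks. -/
theorem sum_det_vandermonde {q : ℝ} (hq0 : 0 < q) (m : ℕ) (x : Fin m → ℤ) :
    ∑ y ∈ Fintype.piFinset (fun i => ({x i - 1, x i} : Finset ℤ)),
      (∏ i, q ^ (((m : ℤ) - 1) * (x i - y i)) * stepWeight q (x i) (y i)) *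
        (Matrix.vandermonde fun i => q ^ y i).det =
      (Matrix.vandermonde fun i => q ^ x i).det * q ^ (m * (m - 1) / 2) := by
  rw [← det_stepMatrix, ← Matrix.det_mul]
  have h := (Matrix.detRowAlternating (n := Fin m) (R := ℝ)).toMultilinearMap.map_sum_finset
    (fun i (z : ℤ) (k : Fin m) =>
      (q ^ (((m : ℤ) - 1) * (x i - z)) * stepWeight q (x i) z) * (q ^ z) ^ (k : ℕ))
    (fun i => ({x i - 1, x i} : Finset ℤ))
  have hr : (Matrix.vandermonde fun i => q ^ x i) * stepMatrix q m =
      fun i => ∑ z ∈ ({x i - 1, x i} : Finset ℤ), fun k : Fin m =>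
        (q ^ (((m : ℤ) - 1) * (x i - z)) * stepWeight q (x i) z) * (q ^ z) ^ (k : ℕ) := by
    ext i k
    rw [Finset.sum_apply, sum_stepWeight_mul hq0]
    simp [Matrix.mul_apply, Matrix.vandermonde_apply]
  rw [hr]
  refine Eq.trans (Finset.sum_congr rfl fun y _ => ?_) h.symm
  rw [← Matrix.det_mul_column]
  rfl

theorem UpsM_eq_det (q : ℝ) (hq0 : 0 < q) (m : ℕ) (x y : Fin m → ℤ) :
    UpsM q m x y = (q ^ (m * (m - 1) / 2))⁻¹ * ((Matrix.vandermonde fun i => q ^ x i).det)⁻¹ *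
      ((∏ i, q ^ (((m : ℤ) - 1) * (x i - y i)) * stepWeight q (x i) (y i)) *
        (Matrix.vandermonde fun i => q ^ y i).det) := by
  have hexp : (m : ℤ) * ((m : ℤ) - 1) / 2 = ((m * (m - 1) / 2 : ℕ) : ℤ) := by
    cases m <;> simp
  have hprod : ∏ i, q ^ (((m : ℤ) - 1) * (x i - y i)) =
      q ^ (((m : ℤ) - 1) * ((∑ i, x i) - ∑ i, y i)) := by
    rw [← Finset.sum_sub_distrib, Finset.mul_sum]
    induction (Finset.univ : Finset (Fin m)) using Finset.induction_on with
    | empty => simp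
    | insert i s hi ih => rw [Finset.prod_insert hi, Finset.sum_insert hi, zpow_add₀ hq0.ne', ih]
  simp only [UpsM, UpsInd_eq_prod_stepWeight, Finset.prod_div_distrib, Matrix.det_vandermonde,
    Finset.prod_mul_distrib, hprod]
  rw [zpow_add₀ hq0.ne', zpow_neg, hexp, zpow_natCast]
  ring

/-- `Υ_m` is a Markov transition matrix on `W_m`: it is nonnegative and its rows sum
to `1` (the sum over `y ∈ W_m` is effectively finite). -/
theorem stmt_5 (q : ℝ) (hq0 : 0 < q) (hq1 : q < 1) (m : ℕ) (hm : 1 ≤ m)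
    (x : Fin m → ℤ) (hx : Wm m x) :
    (∀ y : Fin m → ℤ, Wm m y → 0 ≤ UpsM q m x y) ∧
    ∑' y : {y : Fin m → ℤ // Wm m y}, UpsM q m x y.1 = 1 := by
  refine ⟨fun y hy => UpsM_nonneg hq0 hq1 hx hy, ?_⟩
  have hsub : ∑' y : {y : Fin m → ℤ // Wm m y}, UpsM q m x y.1 = ∑' y, UpsM q m x y := by
    refine tsum_subtype_eq_of_support_subset (s := {y | Wm m y}) fun y hy => ?_
    by_contra h
    exact hy (UpsM_eq_zero_of_not_Wm hx h)
  have hdet : (Matrix.vandermonde fun i => q ^ x i).det ≠ 0 := by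
    rw [Matrix.det_vandermonde_ne_zero_iff]
    exact (zpow_right_injective₀ hq0 hq1.ne).comp hx.1.injective
  rw [hsub, tsum_eq_sum (s := Fintype.piFinset fun i => ({x i - 1, x i} : Finset ℤ))]
  · simp only [UpsM_eq_det q hq0]
    rw [← Finset.mul_sum, sum_det_vandermonde hq0]
    have hpow : q ^ (m * (m - 1) / 2) ≠ 0 := pow_ne_zero _ hq0.ne'
    field_simp
  · intro y hy
    rw [Fintype.mem_piFinset, not_forall] at hy
    obtain ⟨i, hi⟩ := hy
    have hind : UpsInd q m x y = 0 :=
      Finset.prod_eq_zero (Finset.mem_univ i) (stepWeight_eq_zero hi)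
    rw [UpsM, hind, mul_zero]
end

section
/- Fix q ∈ (0,1) and t ∈ ℤ≥0. For every x ∈ ℂ with |x| < 1, the series Σ_{k=0}^{∞} x^k (q^{k+1};q)_t converges and equals (q;q)_t / (x;q)_{t+1}. -/
/-- `(a;q)_k = ∏_{i=0}^{k−1}(1 − a q^i)` for complex `a, q`. -/
noncomputable def qPochC (q a : ℂ) (k : ℕ) : ℂ := ∏ i ∈ Finset.range k, (1 - a * q ^ i)

/-- `(q^s;q)_k = ∏_{i=0}^{k−1}(1 − q^{s+i})` for an arbitrary integer `s`. -/
noncomputable def qPochCInt (q : ℂ) (s : ℤ) (k : ℕ) : ℂ :=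
  ∏ i ∈ Finset.range k, (1 - q ^ (s + i))

theorem qPochC_succ (q a : ℂ) (k : ℕ) : qPochC q a (k + 1) = qPochC q a k * (1 - a * q ^ k) :=
  Finset.prod_range_succ _ _

theorem qPochC_succ' (q a : ℂ) (k : ℕ) :
    qPochC q a (k + 1) = (1 - a) * qPochC q (q * a) k := by
  simp only [qPochC, Finset.prod_range_succ', pow_zero, mul_one]
  rw [mul_comm]
  congr 1
  exact Finset.prod_congr rfl fun i _ => by ring

theorem qPochCInt_natCast_add_one_succ (q : ℂ) (k t : ℕ) :
    qPochCInt q ((k : ℤ) + 1) (t + 1) =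
      qPochCInt q ((k : ℤ) + 1) t * (1 - q ^ (k + 1 + t)) := by
  rw [qPochCInt, Finset.prod_range_succ, qPochCInt]
  norm_cast

theorem qPochC_ne_zero {q x : ℂ} (hq : ‖q‖ ≤ 1) (hx : ‖x‖ < 1) (k : ℕ) : qPochC q x k ≠ 0 := by
  refine Finset.prod_ne_zero_iff.mpr fun i _ h => ?_
  have hlt : ‖x * q ^ i‖ < 1 := by
    rw [norm_mul, norm_pow]
    exact (mul_le_of_le_one_right (norm_nonneg x) (pow_le_one₀ (norm_nonneg q) hq)).trans_lt hx
  rw [← sub_eq_zero.mp h, norm_one] at hlt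
  exact hlt.false

theorem hasSum_pow_mul_qPochCInt {q : ℂ} (hq : ‖q‖ ≤ 1) (t : ℕ) {x : ℂ} (hx : ‖x‖ < 1) :
    HasSum (fun k : ℕ => x ^ k * qPochCInt q ((k : ℤ) + 1) t)
      (qPochC q q t / qPochC q x (t + 1)) := by
  induction t generalizing x with
  | zero => simpa [qPochC, qPochCInt] using hasSum_geometric_of_norm_lt_one hx
  | succ t ih =>
    have hqx : ‖q * x‖ < 1 := by
      rw [norm_mul]
      exact (mul_le_of_le_one_left (norm_nonneg x) hq).trans_lt hx
    have h₁ := qPochC_ne_zero hq hx (t + 1)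
    have h₂ := qPochC_ne_zero hq hqx (t + 1)
    have h₃ := qPochC_ne_zero hq hx (t + 1 + 1)
    have f₁ : (qPochC q x (t + 1))⁻¹ =
        (1 - x * q ^ (t + 1)) * (qPochC q x (t + 1 + 1))⁻¹ := by
      rw [← div_eq_mul_inv, inv_eq_one_div, div_eq_div_iff h₁ h₃, qPochC_succ q x (t + 1)]
      ring
    have f₂ : (qPochC q (q * x) (t + 1))⁻¹ = (1 - x) * (qPochC q x (t + 1 + 1))⁻¹ := by
      rw [← div_eq_mul_inv, inv_eq_one_div, div_eq_div_iff h₂ h₃, qPochC_succ' q x (t + 1)]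
      ring
    have hv : qPochC q q (t + 1) / qPochC q x (t + 1 + 1) =
        qPochC q q t / qPochC q x (t + 1) -
          q ^ (t + 1) * (qPochC q q t / qPochC q (q * x) (t + 1)) := by
      simp only [div_eq_mul_inv]
      rw [qPochC_succ q q t, f₁, f₂]
      ring
    have hf : (fun k : ℕ => x ^ k * qPochCInt q ((k : ℤ) + 1) (t + 1)) = fun k : ℕ =>
        x ^ k * qPochCInt q ((k : ℤ) + 1) t -
          q ^ (t + 1) * ((q * x) ^ k * qPochCInt q ((k : ℤ) + 1) t) := by
      funext k
      rw [qPochCInt_natCast_add_one_succ]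
      ring
    rw [hv, hf]
    exact (ih hx).sub ((ih hqx).mul_left (q ^ (t + 1)))

/-- The `q`-binomial-type summation: for `|x| < 1`,
`Σ_{k≥0} x^k (q^{k+1};q)_t = (q;q)_t / (x;q)_{t+1}` (convergence included). -/
theorem stmt_7 (q : ℝ) (hq0 : 0 < q) (hq1 : q < 1) (t : ℕ) (x : ℂ) (hx : ‖x‖ < 1) :
    HasSum (fun k : ℕ => x ^ k * qPochCInt (q : ℂ) ((k : ℤ) + 1) t)
      (qPochC (q : ℂ) (q : ℂ) t / qPochC (q : ℂ) x (t + 1)) := by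
  refine hasSum_pow_mul_qPochCInt ?_ t hx
  rw [Complex.norm_real, Real.norm_of_nonneg hq0.le]
  exact hq1.le
end

section
/- Fix q ∈ (0,1), m ≥ 1, x ∈ W_m, integers t₁ ≥ 0, t₂ ≥ 1, p₁, p₂ ∈ ℤ, and radii r_z ∈ (q^{p₂}, q^{p₂−1}) and 0 < r_w < min(q^{p₁}, q^{x_1}, r_z). For N large, define K_N = 1_{t₂>t₁} 1_{p₂>p₁} q^{−t₂(p₁−p₂)} (q^{p₁−p₂+1};q)_{t₂−t₁−1}/(q;q)_{t₂−t₁−1} + (1/(2πi)²) ∮_{|z|=r_z} ∮_{|w|=r_w} (1/w) · [z^{−t₂} q^{p₂ t₂}/(w−z)] · Q_N(w) · [(z q^{1−p₂};q)_{t₂−1}/(q;q)_{t₂−1}] · ∏_{j=0}^{N+m−1} [(1−q^j/w)/(1−q^j/z)] · ∏_{r=1}^{m} [(1−q^{x_r}/z)/(1−q^{x_r}/w)] dw dz, where Q_N(w) = (q^{N−1};q^{−1})_{t₁} Σ_{k=0}^{N−t₁−1} [(q^{N−t₁−1};q^{−1})_{N−t₁−1−k}/(q^{N−1};q^{−1})_{N−t₁−1−k}]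 (w q^{−p₁})^{t₁+1+k}. Also define K_lim with the same first summand plus (q^{p₂t₂−p₁t₁−p₁}/(2πi)²) ∮_{|z|=r_z} ∮_{|w|=r_w} [z^{−t₂} w^{t₁}/(w−z)] · [(q;q)_{t₁}/(w q^{−p₁};q)_{t₁+1}] · [(z q^{1−p₂};q)_{t₂−1}/(q;q)_{t₂−1}] · [(w^{−1};q)_∞/(z^{−1};q)_∞] · ∏_{r=1}^{m} [(1−q^{x_r}/z)/(1−q^{x_r}/w)] dw dz. Then lim_{N→∞} K_N = K_lim. -/
/-- `(q^s;q^{−1})_k = ∏_{i=0}^{k−1}(1 − q^{s−i})` for an arbitrary integer `s`. -/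
noncomputable def qPochCIntInv (q : ℂ) (s : ℤ) (k : ℕ) : ℂ :=
  ∏ i ∈ Finset.range k, (1 - q ^ (s - i))

/-- `(a;q)_∞ = ∏_{i=0}^{∞}(1 − a q^i)`. -/
noncomputable def qPochCInf (q a : ℂ) : ℂ := ∏' i : ℕ, (1 - a * q ^ i)

/-- `Q_N(w)` from the limit of the terminating `q`-hypergeometric function. -/
noncomputable def QN (q : ℂ) (t₁ : ℕ) (p₁ : ℤ) (N : ℕ) (w : ℂ) : ℂ :=
  qPochCIntInv q ((N : ℤ) - 1) t₁ *
    ∑ k ∈ Finset.range (N - t₁),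
      (qPochCIntInv q ((N : ℤ) - t₁ - 1) (N - t₁ - 1 - k) /
          qPochCIntInv q ((N : ℤ) - 1) (N - t₁ - 1 - k)) *
        (w * q ^ (-p₁)) ^ (t₁ + 1 + k)

/-- The indicator summand common to `K_N` and `K_lim`. -/
noncomputable def Kind (q : ℂ) (t₁ t₂ : ℕ) (p₁ p₂ : ℤ) : ℂ :=
  if t₁ < t₂ ∧ p₁ < p₂ then
    q ^ (-(t₂ : ℤ) * (p₁ - p₂)) * qPochCInt q (p₁ - p₂ + 1) (t₂ - t₁ - 1) /
      qPochC q q (t₂ - t₁ - 1)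
  else 0

/-- The prelimit kernel `K_N` (double contour integral over `|z| = r_z`, `|w| = r_w`). -/
noncomputable def KN (q : ℂ) (m : ℕ) (x : Fin m → ℤ) (t₁ t₂ : ℕ) (p₁ p₂ : ℤ)
    (rz rw : ℝ) (N : ℕ) : ℂ :=
  Kind q t₁ t₂ p₁ p₂ +
    ((2 * (Real.pi : ℂ) * Complex.I)⁻¹) ^ 2 *
      ∮ z in C(0, rz), ∮ w in C(0, rw),
        (1 / w) * (z ^ (-(t₂ : ℤ)) * q ^ (p₂ * t₂) / (w - z)) * QN q t₁ p₁ N w *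
          (qPochC q (z * q ^ (1 - p₂)) (t₂ - 1) / qPochC q q (t₂ - 1)) *
          (∏ j ∈ Finset.range (N + m), ((1 - q ^ (j : ℤ) / w) / (1 - q ^ (j : ℤ) / z))) *
          ∏ r : Fin m, ((1 - q ^ (x r) / z) / (1 - q ^ (x r) / w))

/-- The limiting kernel `K_lim`. -/
noncomputable def KLim (q : ℂ) (m : ℕ) (x : Fin m → ℤ) (t₁ t₂ : ℕ) (p₁ p₂ : ℤ)
    (rz rw : ℝ) : ℂ :=
  Kind q t₁ t₂ p₁ p₂ +
    q ^ (p₂ * t₂ - p₁ * t₁ - p₁) * ((2 * (Real.pi : ℂ) * Complex.I)⁻¹) ^ 2 *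
      ∮ z in C(0, rz), ∮ w in C(0, rw),
        (z ^ (-(t₂ : ℤ)) * w ^ t₁ / (w - z)) *
          (qPochC q q t₁ / qPochC q (w * q ^ (-p₁)) (t₁ + 1)) *
          (qPochC q (z * q ^ (1 - p₂)) (t₂ - 1) / qPochC q q (t₂ - 1)) *
          (qPochCInf q w⁻¹ / qPochCInf q z⁻¹) *
          ∏ r : Fin m, ((1 - q ^ (x r) / z) / (1 - q ^ (x r) / w))

open Filter Topology

/-- Dominated convergence for iterated circle integrals. -/
theorem tendsto_circleIntegral_circleIntegral {F : ℕ → ℂ → ℂ → ℂ} {G : ℂ → ℂ → ℂ}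
    {c d : ℂ} {R S C : ℝ}
    (hc : ∀ n, Continuous fun p : ℝ × ℝ => F n (circleMap c R p.1) (circleMap d S p.2))
    (hb : ∀ᶠ n in atTop, ∀ a b : ℝ, ‖F n (circleMap c R a) (circleMap d S b)‖ ≤ C)
    (hl : ∀ a b : ℝ, Tendsto (fun n => F n (circleMap c R a) (circleMap d S b)) atTop
      (𝓝 (G (circleMap c R a) (circleMap d S b)))) :
    Tendsto (fun n => ∮ z in C(c, R), ∮ w in C(d, S), F n z w) atTop
      (𝓝 (∮ z in C(c, R), ∮ w in C(d, S), G z w)) := by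
  unfold circleIntegral
  have hcont : ∀ n, Continuous (Function.uncurry fun a b : ℝ =>
      deriv (circleMap d S) b • F n (circleMap c R a) (circleMap d S b)) := by
    intro n
    simp only [deriv_circleMap, Function.uncurry_def]
    exact (by fun_prop : Continuous fun p : ℝ × ℝ => circleMap 0 S p.2 * Complex.I).smul (hc n)
  refine intervalIntegral.tendsto_integral_filter_of_dominated_convergence
    (fun _ => |R| * (|S| * C * |2 * Real.pi - 0|)) ?_ ?_ ?_ ?_
  · refine Eventually.of_forall fun n => Continuous.aestronglyMeasurable ?_
    have h := intervalIntegral.continuous_parametric_intervalIntegral_of_continuous'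
      (μ := MeasureTheory.volume) (hcont n) 0 (2 * Real.pi)
    simp only [deriv_circleMap] at h ⊢
    exact (by fun_prop : Continuous fun p : ℝ => circleMap 0 R p * Complex.I).smul h
  · filter_upwards [hb] with n hn
    refine Eventually.of_forall fun a _ => ?_
    rw [norm_smul, deriv_circleMap, norm_mul, norm_circleMap_zero, Complex.norm_I, mul_one]
    refine mul_le_mul_of_nonneg_left ?_ (abs_nonneg _)
    refine intervalIntegral.norm_integral_le_of_norm_le_const fun b _ => ?_
    rw [norm_smul, deriv_circleMap, norm_mul, norm_circleMap_zero, Complex.norm_I, mul_one]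
    exact mul_le_mul_of_nonneg_left (hn a b) (abs_nonneg _)
  · exact intervalIntegrable_const
  · refine Eventually.of_forall fun a _ => Tendsto.const_smul ?_ _
    refine intervalIntegral.tendsto_integral_filter_of_dominated_convergence
      (fun _ => |S| * C) ?_ ?_ ?_ ?_
    · refine Eventually.of_forall fun n => Continuous.aestronglyMeasurable ?_
      exact (hcont n).comp (Continuous.prodMk_right a)
    · filter_upwards [hb] with n hn
      refine Eventually.of_forall fun b _ => ?_
      rw [norm_smul, deriv_circleMap, norm_mul, norm_circleMap_zero, Complex.norm_I, mul_one]
      exact mul_le_mul_of_nonneg_left (hn a b) (abs_nonneg _)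
    · exact intervalIntegrable_const
    · exact Eventually.of_forall fun b _ => (hl a b).const_smul _

theorem summable_norm_neg_mul_pow {q : ℂ} (hq : ‖q‖ < 1) (a : ℂ) :
    Summable fun i : ℕ => ‖-(a * q ^ i)‖ := by
  simp only [norm_neg, norm_mul, norm_pow]
  exact (summable_geometric_of_lt_one (norm_nonneg _) hq).mul_left _

theorem tendsto_qPochC {q : ℂ} (hq : ‖q‖ < 1) (a : ℂ) :
    Tendsto (qPochC q a) atTop (𝓝 (qPochCInf q a)) := by
  have h := (multipliable_one_add_of_summable
    (summable_norm_neg_mul_pow hq a)).hasProd.tendsto_prod_nat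
  simp only [← sub_eq_add_neg] at h
  exact h

theorem qPochCInf_ne_zero {q a : ℂ} (hq : ‖q‖ < 1) (ha : ∀ i : ℕ, ‖a‖ * ‖q‖ ^ i ≠ 1) :
    qPochCInf q a ≠ 0 := by
  have h := tprod_one_add_ne_zero_of_summable (f := fun i : ℕ => -(a * q ^ i))
    (fun i h => ha i ?_) (summable_norm_neg_mul_pow hq a)
  · simp only [← sub_eq_add_neg] at h
    exact h
  · rw [← sub_eq_add_neg, sub_eq_zero] at h
    rw [← norm_pow, ← norm_mul, ← h, norm_one]

theorem exists_norm_qPochC_le {q : ℂ} (hq : ‖q‖ < 1) (r : ℝ) :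
    ∃ C, ∀ a : ℂ, ‖a‖ = r → ∀ n, ‖qPochC q a n‖ ≤ C := by
  have hs : Summable fun i : ℕ => ‖r * ‖q‖ ^ i‖ :=
    ((summable_geometric_of_lt_one (norm_nonneg _) hq).mul_left r).norm
  obtain ⟨C, hC⟩ := (multipliable_one_add_of_summable hs).hasProd.tendsto_prod_nat.bddAbove_range
  refine ⟨C, fun a ha n => le_trans ?_ (hC ⟨n, rfl⟩)⟩
  rw [qPochC, norm_prod]
  refine Finset.prod_le_prod (fun _ _ => norm_nonneg _) fun i _ => ?_
  refine (norm_sub_le _ _).trans ?_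
  simp [ha]

theorem exists_norm_inv_qPochC_le {q : ℂ} (hq : ‖q‖ < 1) {r : ℝ}
    (hr : ∀ i : ℕ, r * ‖q‖ ^ i ≠ 1) :
    ∃ C, ∀ a : ℂ, ‖a‖ = r → ∀ n, ‖(qPochC q a n)⁻¹‖ ≤ C := by
  by_cases hr0 : 0 ≤ r
  swap
  · exact ⟨0, fun a ha => absurd (ha ▸ norm_nonneg a) hr0⟩
  have hq' : ‖(‖q‖ : ℂ)‖ < 1 := by simpa using hq
  have hn : ‖(r : ℂ)‖ = r := by simp [abs_of_nonneg hr0]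
  have h0 : qPochCInf (‖q‖ : ℂ) r ≠ 0 := by
    refine qPochCInf_ne_zero hq' fun i => ?_
    rw [hn, Complex.norm_real, norm_norm]
    exact hr i
  obtain ⟨C, hC⟩ := ((tendsto_qPochC hq' (r : ℂ)).inv₀ h0).norm.bddAbove_range
  refine ⟨C, fun a ha n => le_trans ?_ (hC ⟨n, rfl⟩)⟩
  simp only [norm_inv, qPochC, norm_prod, ← Finset.prod_inv_distrib]
  refine Finset.prod_le_prod (fun _ _ => by positivity) fun i _ => ?_
  have e : (1 - (r : ℂ) * (‖q‖ : ℂ) ^ i) = ((1 - r * ‖q‖ ^ i : ℝ) : ℂ) := by push_cast; ring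
  rw [e, Complex.norm_real]
  refine inv_anti₀ (norm_pos_iff.2 (sub_ne_zero.2 (hr i).symm)) ?_
  have h := abs_norm_sub_norm_le (1 : ℂ) (a * q ^ i)
  simpa [ha] using h

/-- The `q`-binomial series. -/
theorem hasSum_prod_one_sub_mul_pow {q : ℂ} (hq : ‖q‖ < 1) (t : ℕ) {u : ℂ} (hu : ‖u‖ < 1) :
    HasSum (fun k : ℕ => (∏ i ∈ Finset.range t, (1 - q ^ (k + i + 1))) * u ^ k)
      (qPochC q q t / qPochC q u (t + 1)) := by
  have hne : ∀ {v : ℂ}, ‖v‖ < 1 → ∀ i : ℕ, 1 - v * q ^ i ≠ 0 := by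
    intro v hv i h
    have h1 : ‖v * q ^ i‖ = 1 := by rw [← sub_eq_zero.1 h, norm_one]
    rw [norm_mul, norm_pow] at h1
    have : ‖q‖ ^ i ≤ 1 := pow_le_one₀ (norm_nonneg _) hq.le
    nlinarith [norm_nonneg v]
  induction t generalizing u with
  | zero => simpa [qPochC] using hasSum_geometric_of_norm_lt_one hu
  | succ t ih =>
    have hqu : ‖q * u‖ < 1 := by
      rw [norm_mul]
      nlinarith [norm_nonneg q, norm_nonneg u]
    have h := (ih hu).sub ((ih hqu).mul_left (q ^ (t + 1)))
    convert! h using 1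
    · ext k
      rw [Finset.prod_range_succ]
      ring
    · have hP : qPochC q (q * u) t ≠ 0 :=
        Finset.prod_ne_zero_iff.2 fun i _ => hne hqu i
      have e1 : ∀ n, qPochC q u (n + 1) = (1 - u) * qPochC q (q * u) n := by
        intro n
        rw [qPochC, Finset.prod_range_succ', mul_comm, qPochC]
        simp only [pow_zero, mul_one]
        congr 1
        exact Finset.prod_congr rfl fun i _ => by ring
      have e2 : ∀ v n, qPochC q v (n + 1) = qPochC q v n * (1 - v * q ^ n) :=
        fun v n => Finset.prod_range_succ _ _
      have h1 : 1 - u ≠ 0 := by simpa using hne hu 0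
      have h2 : 1 - q * u * q ^ t ≠ 0 := hne hqu t
      rw [e1 (t + 1), e1 t, e2 (q * u), e2 q, pow_succ]
      generalize hD : 1 - q * u * q ^ t = D at h2 ⊢
      field_simp
      rw [← hD]
      ring

theorem qPochCIntInv_mul_qPochC {q : ℂ} {n M : ℕ} (h : n ≤ M) :
    qPochCIntInv q M n * qPochC q q (M - n) = qPochC q q M := by
  induction n with
  | zero => simp [qPochCIntInv]
  | succ n ih =>
    rw [← ih (by omega), show M - n = (M - (n + 1)) + 1 by omega]
    have e : (M : ℤ) - n = ((M - (n + 1) + 1 : ℕ) : ℤ) := by omega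
    simp only [qPochCIntInv, qPochC, Finset.prod_range_succ, e, zpow_natCast]
    ring

theorem qPochC_self_ne_zero {q : ℂ} (hq : ‖q‖ < 1) (n : ℕ) : qPochC q q n ≠ 0 := by
  refine Finset.prod_ne_zero_iff.2 fun i _ h => ?_
  have h1 : ‖q ^ (i + 1)‖ = 1 := by rw [pow_succ', ← sub_eq_zero.1 h, norm_one]
  rw [norm_pow] at h1
  exact (pow_lt_one₀ (norm_nonneg _) hq (by omega)).ne h1

theorem QN_eq_sum {q : ℂ} (hq : ‖q‖ < 1) {t N : ℕ} (hN : t < N) (p : ℤ) (w : ℂ) :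
    QN q t p N w = ∑ k ∈ Finset.range (N - t),
      (w * q ^ (-p)) ^ (t + 1) *
        ((∏ i ∈ Finset.range t, (1 - q ^ (k + i + 1))) * (w * q ^ (-p)) ^ k) := by
  rw [QN, Finset.mul_sum]
  refine Finset.sum_congr rfl fun k hk => ?_
  rw [Finset.mem_range] at hk
  have hP : qPochC q q k * ∏ i ∈ Finset.range t, (1 - q ^ (k + i + 1)) = qPochC q q (t + k) := by
    rw [add_comm t k]
    simp only [qPochC, Finset.prod_range_add]
    congr 1
    exact Finset.prod_congr rfl fun i _ => by ring
  have e1 : (N : ℤ) - 1 = ((N - 1 : ℕ) : ℤ) := by omega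
  have e2 : (N : ℤ) - t - 1 = ((N - t - 1 : ℕ) : ℤ) := by omega
  have h1 := qPochCIntInv_mul_qPochC (q := q) (show t ≤ N - 1 by omega)
  have h2 := qPochCIntInv_mul_qPochC (q := q) (show N - t - 1 - k ≤ N - t - 1 by omega)
  have h3 := qPochCIntInv_mul_qPochC (q := q) (show N - t - 1 - k ≤ N - 1 by omega)
  rw [show N - 1 - t = N - t - 1 by omega] at h1
  rw [show N - t - 1 - (N - t - 1 - k) = k by omega] at h2
  rw [show N - 1 - (N - t - 1 - k) = t + k by omega, ← hP] at h3
  rw [e1, e2]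
  have n0 := qPochC_self_ne_zero hq (N - 1)
  have n1 := qPochC_self_ne_zero hq (N - t - 1)
  have n2 := qPochC_self_ne_zero hq k
  have n3 : qPochCIntInv q ((N - 1 : ℕ) : ℤ) (N - t - 1 - k) ≠ 0 := by
    intro h
    rw [h, zero_mul] at h3
    exact n0 h3.symm
  have key : qPochCIntInv q ((N - 1 : ℕ) : ℤ) t *
      (qPochCIntInv q ((N - t - 1 : ℕ) : ℤ) (N - t - 1 - k) /
        qPochCIntInv q ((N - 1 : ℕ) : ℤ) (N - t - 1 - k)) =
      ∏ i ∈ Finset.range t, (1 - q ^ (k + i + 1)) := by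
    rw [mul_div_assoc', div_eq_iff n3]
    refine mul_right_cancel₀ n2 (mul_right_cancel₀ n1 ?_)
    linear_combination qPochC q q (N - t - 1) * qPochCIntInv q ((N - 1 : ℕ) : ℤ) t * h2 +
      qPochC q q (N - t - 1) * h1 - qPochC q q (N - t - 1) * h3
  rw [← mul_assoc, key, pow_add]
  ring

theorem tendsto_QN {q : ℂ} (hq : ‖q‖ < 1) (t : ℕ) (p : ℤ) {w : ℂ} (hw : ‖w * q ^ (-p)‖ < 1) :
    Tendsto (fun N => QN q t p N w) atTop
      (𝓝 ((w * q ^ (-p)) ^ (t + 1) * (qPochC q q t / qPochC q (w * q ^ (-p)) (t + 1)))) := by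
  have h := ((hasSum_prod_one_sub_mul_pow hq t hw).mul_left
    ((w * q ^ (-p)) ^ (t + 1))).tendsto_sum_nat.comp (tendsto_sub_atTop_nat t)
  refine h.congr' ?_
  filter_upwards [eventually_gt_atTop t] with N hN
  exact (QN_eq_sum hq hN p w).symm

theorem exists_norm_QN_le {q : ℂ} (hq : ‖q‖ < 1) (t : ℕ) (p : ℤ) {ρ : ℝ} (hρ0 : 0 ≤ ρ)
    (hρ : ρ < 1) :
    ∃ C, ∀ w : ℂ, ‖w * q ^ (-p)‖ = ρ → ∀ N, t < N → ‖QN q t p N w‖ ≤ C := by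
  have hs : Summable fun k : ℕ => ρ ^ (t + 1) * (2 ^ t * ρ ^ k) :=
    ((summable_geometric_of_lt_one hρ0 hρ).mul_left _).mul_left _
  refine ⟨∑' k : ℕ, ρ ^ (t + 1) * (2 ^ t * ρ ^ k), fun w hw N hN => ?_⟩
  rw [QN_eq_sum hq hN]
  refine (norm_sum_le _ _).trans (le_trans (Finset.sum_le_sum fun k _ => ?_)
    (hs.sum_le_tsum (Finset.range (N - t)) fun k _ => by positivity))
  rw [norm_mul, norm_mul, norm_pow, norm_pow, hw, norm_prod]
  gcongr
  refine (Finset.prod_le_prod (fun _ _ => norm_nonneg _) (g := fun _ => 2) fun i _ => ?_).trans (by simp)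
  refine (norm_sub_le _ _).trans ?_
  rw [norm_one, norm_pow]
  linarith [pow_le_one₀ (n := k + i + 1) (norm_nonneg q) hq.le]

theorem continuous_qPochC (q : ℂ) (n : ℕ) : Continuous fun a => qPochC q a n := by
  unfold qPochC
  fun_prop

theorem continuous_QN (q : ℂ) (t : ℕ) (p : ℤ) (N : ℕ) : Continuous (QN q t p N) := by
  unfold QN
  fun_prop

theorem qPochC_ne_zero_s9 {q a : ℂ} (ha : ∀ i : ℕ, ‖a‖ * ‖q‖ ^ i ≠ 1) (n : ℕ) :
    qPochC q a n ≠ 0 := by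
  refine Finset.prod_ne_zero_iff.2 fun i _ h => ha i ?_
  rw [← norm_pow, ← norm_mul, ← sub_eq_zero.1 h, norm_one]

theorem prod_one_sub_zpow_div (q z w : ℂ) (n : ℕ) :
    ∏ j ∈ Finset.range n, ((1 - q ^ (j : ℤ) / w) / (1 - q ^ (j : ℤ) / z)) =
      qPochC q w⁻¹ n * (qPochC q z⁻¹ n)⁻¹ := by
  rw [Finset.prod_div_distrib, div_eq_mul_inv]
  simp only [qPochC, zpow_natCast, div_eq_inv_mul]

/-- The factor of the integrand of `KN` that does not depend on `N`. -/
noncomputable def kernelFactor (q : ℂ) (m : ℕ) (x : Fin m → ℤ) (t₂ : ℕ) (p₂ : ℤ) (z w : ℂ) : ℂ :=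
  (1 / w) * (z ^ (-(t₂ : ℤ)) * q ^ (p₂ * t₂) / (w - z)) *
    (qPochC q (z * q ^ (1 - p₂)) (t₂ - 1) / qPochC q q (t₂ - 1)) *
    ∏ r : Fin m, ((1 - q ^ (x r) / z) / (1 - q ^ (x r) / w))

theorem continuous_kernelFactor_circleMap {q : ℂ} {m : ℕ} {x : Fin m → ℤ} {t₂ : ℕ} {p₂ : ℤ}
    {rz rw : ℝ} (hrw : 0 < rw) (hlt : rw < rz) (hx : ∀ r, rw < ‖q ^ x r‖) :
    Continuous fun p : ℝ × ℝ =>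
      kernelFactor q m x t₂ p₂ (circleMap 0 rz p.1) (circleMap 0 rw p.2) := by
  have hz : ∀ a, circleMap 0 rz a ≠ 0 := fun a => circleMap_ne_center (hrw.trans hlt).ne'
  have hw : ∀ a, circleMap 0 rw a ≠ 0 := fun a => circleMap_ne_center hrw.ne'
  have hwz : ∀ a b, circleMap 0 rw b - circleMap 0 rz a ≠ 0 := by
    intro a b h
    have := congrArg norm (sub_eq_zero.1 h)
    rw [norm_circleMap_zero, norm_circleMap_zero, abs_of_pos hrw, abs_of_pos (hrw.trans hlt)] at this
    exact hlt.ne this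
  have hxw : ∀ r b, 1 - q ^ x r / circleMap 0 rw b ≠ 0 := by
    intro r b h
    rw [sub_eq_zero, eq_div_iff (hw b), one_mul] at h
    have := hx r
    rw [← h, norm_circleMap_zero, abs_of_pos hrw] at this
    exact lt_irrefl _ this
  have c1 : Continuous fun p : ℝ × ℝ => circleMap 0 rz p.1 := by fun_prop
  have c2 : Continuous fun p : ℝ × ℝ => circleMap 0 rw p.2 := by fun_prop
  unfold kernelFactor
  refine ((Continuous.mul ?_ ?_).mul (Continuous.div_const ?_ _)).mul
    (continuous_finsetProd _ fun r _ => ?_)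
  · exact continuous_const.div c2 fun p => hw p.2
  · exact ((c1.zpow₀ _ fun p => Or.inl (hz p.1)).mul continuous_const).div (c2.sub c1)
      fun p => hwz p.1 p.2
  · exact (continuous_qPochC q _).comp (c1.mul continuous_const)
  · exact (continuous_const.sub (continuous_const.div c1 fun p => hz p.1)).div
      (continuous_const.sub (continuous_const.div c2 fun p => hw p.2)) fun p => hxw r p.2

theorem exists_norm_comp_circleMap_le {f : ℂ → ℂ → ℂ} {c d : ℂ} {R S : ℝ}
    (hf : Continuous fun p : ℝ × ℝ => f (circleMap c R p.1) (circleMap d S p.2)) :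
    ∃ C, ∀ a b : ℝ, ‖f (circleMap c R a) (circleMap d S b)‖ ≤ C := by
  obtain ⟨C, hC⟩ := ((isCompact_Icc (a := (0 : ℝ)) (b := 2 * Real.pi)).prod
    (isCompact_Icc (a := (0 : ℝ)) (b := 2 * Real.pi))).exists_bound_of_continuousOn hf.continuousOn
  refine ⟨C, fun a b => ?_⟩
  obtain ⟨a', ha', ha⟩ := (periodic_circleMap c R).exists_mem_Ico₀ Real.two_pi_pos a
  obtain ⟨b', hb', hb⟩ := (periodic_circleMap d S).exists_mem_Ico₀ Real.two_pi_pos b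
  rw [ha, hb]
  exact hC (a', b') ⟨Set.Ico_subset_Icc_self ha', Set.Ico_subset_Icc_self hb'⟩

/-- Convergence `K_N → K_lim` of the lozenge-tiling correlation kernel to the
kernel of the noncolliding `q`-exchangeable walks. -/
theorem stmt_9 (q : ℝ) (hq0 : 0 < q) (hq1 : q < 1) (m : ℕ) (hm : 1 ≤ m)
    (x : Fin m → ℤ) (hx : Wm m x) (t₁ t₂ : ℕ) (ht₂ : 1 ≤ t₂) (p₁ p₂ : ℤ)
    (rz rw : ℝ) (hrz1 : q ^ p₂ < rz) (hrz2 : rz < q ^ (p₂ - 1))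
    (hrw0 : 0 < rw) (hrw : rw < min (q ^ p₁) (min (q ^ (x ⟨0, hm⟩)) rz)) :
    Filter.Tendsto (fun N : ℕ => KN (q : ℂ) m x t₁ t₂ p₁ p₂ rz rw N) Filter.atTop
      (nhds (KLim (q : ℂ) m x t₁ t₂ p₁ p₂ rz rw)) := by
  obtain ⟨hrwp, hrwx, hrwz⟩ : rw < q ^ p₁ ∧ rw < q ^ x ⟨0, hm⟩ ∧ rw < rz := by
    simpa only [lt_min_iff] using hrw
  have hrz0 : 0 < rz := hrw0.trans hrwz
  have hnorm : ‖(q : ℂ)‖ = q := by simp [abs_of_pos hq0]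
  have hq : ‖(q : ℂ)‖ < 1 := by rwa [hnorm]
  have hqc : (q : ℂ) ≠ 0 := by exact_mod_cast hq0.ne'
  have hxr : ∀ r, rw < ‖(q : ℂ) ^ x r‖ := by
    intro r
    rw [norm_zpow, hnorm]
    refine hrwx.trans_le (zpow_le_zpow_right_of_le_one₀ hq0 hq1.le (hx.1.antitone ?_))
    exact Fin.le_def.2 (Nat.zero_le _)
  have hzi : ∀ i : ℕ, rz⁻¹ * ‖(q : ℂ)‖ ^ i ≠ 1 := by
    intro i h
    rw [hnorm, inv_mul_eq_one₀ hrz0.ne'] at h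
    rw [h, ← zpow_natCast] at hrz1 hrz2
    have h1 := (zpow_lt_zpow_iff_right_of_lt_one₀ hq0 hq1).1 hrz1
    have h2 := (zpow_lt_zpow_iff_right_of_lt_one₀ hq0 hq1).1 hrz2
    omega
  have hzn : ∀ a, ‖(circleMap 0 rz a)⁻¹‖ = rz⁻¹ := fun a => by
    rw [norm_inv, norm_circleMap_zero, abs_of_pos hrz0]
  have hwn : ∀ b, ‖(circleMap 0 rw b)⁻¹‖ = rw⁻¹ := fun b => by
    rw [norm_inv, norm_circleMap_zero, abs_of_pos hrw0]
  have hu : ∀ b, ‖circleMap 0 rw b * (q : ℂ) ^ (-p₁)‖ = rw * q ^ (-p₁) := fun b => by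
    rw [norm_mul, norm_circleMap_zero, abs_of_pos hrw0, norm_zpow, hnorm]
  have hρ : rw * q ^ (-p₁) < 1 := by
    rwa [zpow_neg, ← div_eq_mul_inv, div_lt_one (zpow_pos hq0 _)]
  have hcA := continuous_kernelFactor_circleMap (t₂ := t₂) (p₂ := p₂) hrw0 hrwz hxr
  obtain ⟨CA, hCA⟩ := exists_norm_comp_circleMap_le hcA
  obtain ⟨CQ, hCQ⟩ := exists_norm_QN_le hq t₁ p₁ (by positivity) hρ
  obtain ⟨CW, hCW⟩ := exists_norm_qPochC_le hq rw⁻¹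
  obtain ⟨CZ, hCZ⟩ := exists_norm_inv_qPochC_le hq hzi
  have hF : ∀ N, KN (q : ℂ) m x t₁ t₂ p₁ p₂ rz rw N = Kind q t₁ t₂ p₁ p₂ +
      ((2 * (Real.pi : ℂ) * Complex.I)⁻¹) ^ 2 * ∮ z in C(0, rz), ∮ w in C(0, rw),
        kernelFactor q m x t₂ p₂ z w * QN q t₁ p₁ N w *
          (qPochC q w⁻¹ (N + m) * (qPochC q z⁻¹ (N + m))⁻¹) := by
    intro N
    simp only [KN, prod_one_sub_zpow_div, kernelFactor]
    congr 4
    ext z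
    congr 1
    ext w
    ring
  simp only [hF]
  rw [KLim, mul_comm ((q : ℂ) ^ _), mul_assoc (((2 * (Real.pi : ℂ) * Complex.I)⁻¹) ^ 2),
    ← circleIntegral.integral_const_mul]
  simp only [← circleIntegral.integral_const_mul _ _ (0 : ℂ) rw]
  refine Tendsto.const_add _ (Tendsto.const_mul _ ?_)
  refine tendsto_circleIntegral_circleIntegral (C := CA * CQ * (CW * CZ)) ?_ ?_ ?_
  · intro N
    refine (hcA.mul ((continuous_QN q t₁ p₁ N).comp (by fun_prop))).mul (.mul ?_ (.inv₀ ?_ ?_))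
    · refine (continuous_qPochC q _).comp (.inv₀ (by fun_prop) fun p => ?_)
      exact circleMap_ne_center hrw0.ne'
    · refine (continuous_qPochC q _).comp (.inv₀ (by fun_prop) fun p => ?_)
      exact circleMap_ne_center hrz0.ne'
    · exact fun p => qPochC_ne_zero_s9 (by rwa [hzn]) _
  · filter_upwards [eventually_gt_atTop t₁] with N hN a b
    rw [norm_mul, norm_mul, norm_mul]
    have h1 := hCA a b
    have h2 := hCQ _ (hu b) N hN
    have h3 := hCW _ (hwn b) (N + m)
    have h4 := hCZ _ (hzn a) (N + m)
    have := (norm_nonneg _).trans h1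
    have := (norm_nonneg _).trans h2
    have := (norm_nonneg _).trans h3
    gcongr
  · intro a b
    have hw : circleMap 0 rw b ≠ 0 := circleMap_ne_center hrw0.ne'
    have hinf : qPochCInf (q : ℂ) (circleMap 0 rz a)⁻¹ ≠ 0 :=
      qPochCInf_ne_zero hq (by rwa [hzn])
    have hQ := tendsto_QN hq t₁ p₁ (w := circleMap 0 rw b) (by rwa [hu])
    have hadd := tendsto_add_atTop_nat m
    have h := (hQ.const_mul (kernelFactor q m x t₂ p₂ (circleMap 0 rz a) (circleMap 0 rw b))).mul
      (((tendsto_qPochC hq (circleMap 0 rw b)⁻¹).comp hadd).mul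
        (((tendsto_qPochC hq (circleMap 0 rz a)⁻¹).comp hadd).inv₀ hinf))
    convert h using 2
    · rfl
    have e : (q : ℂ) ^ (p₂ * t₂ - p₁ * t₁ - p₁) =
        (q : ℂ) ^ (p₂ * t₂) * ((q : ℂ) ^ (-p₁)) ^ (t₁ + 1) := by
      rw [← zpow_natCast, ← zpow_mul, ← zpow_add₀ hqc]
      congr 1
      push_cast
      ring
    rw [e, kernelFactor, mul_pow]
    generalize circleMap 0 rw b = w at hw ⊢
    generalize (q : ℂ) ^ (-p₁) = Q
    have hwt : w ^ t₁ = 1 / w * w ^ (t₁ + 1) := by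
      rw [pow_succ]
      field_simp
    rw [hwt]
    simp only [div_eq_mul_inv]
    ring
end
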